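/- arXiv:1512.04493 — 2 statements merged into one kernel-verified Lean document; each statement's English description precedes it below -/
import Mathlib

section
/- For every t with 0 < t ≤ 1/2 and every x ≥ 0, one has 2·p(t,x) + ∫₀ᵗ 2·p(t−s,x) ds = ∫ₓ^∞ u₁(t,y) dy. In other words, in the absorption phase the function U*(t,x) := 2p(t,x) + ∫₀ᵗ 2p(t−s,x) ds is the tail distribution function of the density u₁(t,·). -/
open MeasureTheory Real Set

/-- The heat kernel `p(t,x) = (2πt)^{-1/2} exp(-x²/(2t))`. -/
noncomputable def heatK (t x : ℝ) : ℝ :=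
  (Real.sqrt (2 * Real.pi * t))⁻¹ * Real.exp (-x ^ 2 / (2 * t))

/-- The Gaussian tail `Φ̃(t,x) = ∫ₓ^∞ p(t,y) dy`. -/
noncomputable def gaussTail (t x : ℝ) : ℝ := ∫ y in Set.Ioi x, heatK t y

/-- The density `u₁(t,x) = -2∂ₓp(t,x) + 4Φ̃(t,x) = (2x/t)p(t,x) + 4Φ̃(t,x)`. -/
noncomputable def u1 (t x : ℝ) : ℝ := (2 * x / t) * heatK t x + 4 * gaussTail t x

open Filter Topology

lemma heatK_nonneg (t x : ℝ) : 0 ≤ heatK t x := by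
  unfold heatK; positivity

lemma continuous_heatK (t : ℝ) : Continuous (heatK t) := by
  unfold heatK; fun_prop

lemma hasDerivAt_heatK_space {t : ℝ} (ht : 0 < t) (x : ℝ) :
    HasDerivAt (heatK t) (-(x / t) * heatK t x) x := by
  have h : HasDerivAt (fun y : ℝ => -y ^ 2 / (2 * t)) (-(x / t)) x := by
    refine ((hasDerivAt_pow 2 x).neg.div_const (2 * t)).congr_deriv ?_
    field_simp
    norm_num
  refine (h.exp.const_mul (Real.sqrt (2 * Real.pi * t))⁻¹).congr_deriv ?_
  unfold heatK
  ring

lemma heatK_eq_gaussian (t x : ℝ) :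
    heatK t x = (Real.sqrt (2 * Real.pi * t))⁻¹ * Real.exp (-(1 / (2 * t)) * x ^ 2) := by
  unfold heatK
  congr 2
  ring

lemma integrable_heatK {t : ℝ} (ht : 0 < t) : Integrable (heatK t) := by
  simp_rw [funext (heatK_eq_gaussian t)]
  exact (integrable_exp_neg_mul_sq (by positivity)).const_mul _

lemma integrable_mul_heatK {t : ℝ} (ht : 0 < t) : Integrable (fun y => y * heatK t y) := by
  have h := (integrable_mul_exp_neg_mul_sq (b := 1 / (2 * t)) (by positivity)).const_mul
    (Real.sqrt (2 * Real.pi * t))⁻¹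
  refine h.congr (ae_of_all _ fun y => ?_)
  simp only [heatK_eq_gaussian]
  ring

lemma tendsto_heatK_atTop {t : ℝ} (ht : 0 < t) : Tendsto (heatK t) atTop (𝓝 0) := by
  have h : Tendsto (fun y : ℝ => -(1 / (2 * t)) * y ^ 2) atTop atBot :=
    (tendsto_pow_atTop two_ne_zero).const_mul_atTop_of_neg
      (neg_neg_of_pos (by positivity))
  have h2 := (tendsto_exp_atBot.comp h).const_mul (Real.sqrt (2 * Real.pi * t))⁻¹
  rw [mul_zero] at h2
  exact h2.congr fun y => (heatK_eq_gaussian t y).symm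

lemma gaussTail_nonneg (t x : ℝ) : 0 ≤ gaussTail t x :=
  integral_nonneg fun y => heatK_nonneg t y

lemma hasDerivAt_gaussTail {t : ℝ} (ht : 0 < t) (x : ℝ) :
    HasDerivAt (gaussTail t) (-heatK t x) x := by
  have h : gaussTail t = fun y => gaussTail t 0 - ∫ z in (0 : ℝ)..y, heatK t z := by
    funext y
    rw [← intervalIntegral.integral_Ioi_sub_Ioi' (integrable_heatK ht).integrableOn
      (integrable_heatK ht).integrableOn]
    simp [gaussTail]
  rw [h]
  exact ((continuous_heatK t).integral_hasStrictDerivAt 0 x).hasDerivAt.const_sub _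

lemma integral_Ioi_mul_heatK {t : ℝ} (ht : 0 < t) {x : ℝ} (hx : 0 ≤ x) :
    ∫ y in Ioi x, y * heatK t y = t * heatK t x := by
  have h := integral_Ioi_of_hasDerivAt_of_nonneg' (g := fun y => -t * heatK t y)
    (g' := fun y => y * heatK t y) (a := x) (l := -t * 0)
    (fun y _ => by
      refine ((hasDerivAt_heatK_space ht y).const_mul (-t)).congr_deriv ?_
      field_simp)
    (fun y hy => mul_nonneg (hx.trans (le_of_lt hy)) (heatK_nonneg t y))
    ((tendsto_heatK_atTop ht).const_mul (-t))
  rw [h]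
  ring

lemma mul_gaussTail_le {t : ℝ} (ht : 0 < t) {x : ℝ} (hx : 0 ≤ x) :
    x * gaussTail t x ≤ t * heatK t x := by
  rw [← integral_Ioi_mul_heatK ht hx, gaussTail, ← integral_const_mul]
  exact setIntegral_mono_on ((integrable_heatK ht).const_mul x).integrableOn
    (integrable_mul_heatK ht).integrableOn measurableSet_Ioi
    fun y hy => mul_le_mul_of_nonneg_right (le_of_lt hy) (heatK_nonneg t y)

lemma tendsto_mul_gaussTail_atTop {t : ℝ} (ht : 0 < t) :
    Tendsto (fun x => x * gaussTail t x) atTop (𝓝 0) := by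
  refine squeeze_zero' ?_ ?_ (g := fun x => t * heatK t x) ?_
  · filter_upwards [eventually_ge_atTop 0] with x hx
    exact mul_nonneg hx (gaussTail_nonneg t x)
  · filter_upwards [eventually_ge_atTop 0] with x hx
    exact mul_gaussTail_le ht hx
  · simpa using (tendsto_heatK_atTop ht).const_mul t

lemma tendsto_gaussTail_atTop {t : ℝ} (ht : 0 < t) :
    Tendsto (gaussTail t) atTop (𝓝 0) := by
  refine squeeze_zero' (Eventually.of_forall (gaussTail_nonneg t)) ?_
    (tendsto_mul_gaussTail_atTop ht)
  filter_upwards [eventually_ge_atTop 1] with x hx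
  exact le_mul_of_one_le_left (gaussTail_nonneg t x) hx

lemma integral_Ioi_u1 {t : ℝ} (ht : 0 < t) {x : ℝ} (hx : 0 ≤ x) :
    ∫ y in Ioi x, u1 t y = 2 * heatK t x + 4 * (t * heatK t x - x * gaussTail t x) := by
  have hl := ((tendsto_heatK_atTop ht).const_mul (-2 - 4 * t)).add
    ((tendsto_mul_gaussTail_atTop ht).const_mul 4)
  have h := integral_Ioi_of_hasDerivAt_of_nonneg'
    (g := fun y => (-2 - 4 * t) * heatK t y + 4 * (y * gaussTail t y))
    (g' := u1 t) (a := x)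
    (fun y _ => by
      refine (((hasDerivAt_heatK_space ht y).const_mul (-2 - 4 * t)).add
        (((hasDerivAt_id y).mul (hasDerivAt_gaussTail ht y)).const_mul 4)).congr_deriv ?_
      simp only [u1, id]
      field_simp
      ring)
    (fun y hy => by
      have hy' : 0 ≤ y := hx.trans (le_of_lt hy)
      have := heatK_nonneg t y
      have := gaussTail_nonneg t y
      unfold u1
      positivity) hl
  rw [h]
  ring

lemma heatK_eq_scaled {t : ℝ} (ht : 0 < t) (x : ℝ) :
    heatK t x = (Real.sqrt t)⁻¹ * heatK 1 ((Real.sqrt t)⁻¹ * x) := by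
  unfold heatK
  rw [Real.sqrt_mul (by positivity) t, mul_one, mul_inv, mul_pow, inv_pow, Real.sq_sqrt ht.le,
    mul_comm (Real.sqrt (2 * Real.pi))⁻¹, mul_assoc]
  congr 3
  field_simp

lemma gaussTail_eq_scaled {t : ℝ} (ht : 0 < t) (x : ℝ) :
    gaussTail t x = gaussTail 1 ((Real.sqrt t)⁻¹ * x) := by
  have hs : 0 < (Real.sqrt t)⁻¹ := inv_pos.2 (Real.sqrt_pos.2 ht)
  unfold gaussTail
  simp_rw [heatK_eq_scaled ht]
  rw [integral_const_mul, integral_comp_mul_left_Ioi (heatK 1) x hs, smul_eq_mul,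
    mul_inv_cancel_left₀ hs.ne']

lemma hasDerivAt_inv_sqrt {t : ℝ} (ht : 0 < t) :
    HasDerivAt (fun s => (Real.sqrt s)⁻¹) (-(Real.sqrt t)⁻¹ / (2 * t)) t := by
  have hs := Real.sqrt_pos.2 ht
  refine ((Real.hasDerivAt_sqrt ht.ne').inv hs.ne').congr_deriv ?_
  rw [Real.sq_sqrt ht.le]
  field_simp

lemma hasDerivAt_gaussTail_time {t : ℝ} (ht : 0 < t) (x : ℝ) :
    HasDerivAt (fun s => gaussTail s x) (x / (2 * t) * heatK t x) t := by
  have h := (hasDerivAt_gaussTail one_pos ((Real.sqrt t)⁻¹ * x)).comp t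
    ((hasDerivAt_inv_sqrt ht).mul_const x)
  refine (h.congr_of_eventuallyEq ?_).congr_deriv ?_
  · filter_upwards [lt_mem_nhds ht] with s hs
    exact gaussTail_eq_scaled hs x
  · rw [heatK_eq_scaled ht]
    ring

lemma hasDerivAt_heatK_time {t : ℝ} (ht : 0 < t) (x : ℝ) :
    HasDerivAt (fun s => heatK s x) ((x ^ 2 / t - 1) / (2 * t) * heatK t x) t := by
  have h := (hasDerivAt_inv_sqrt ht).mul
    ((hasDerivAt_heatK_space one_pos ((Real.sqrt t)⁻¹ * x)).comp t
      ((hasDerivAt_inv_sqrt ht).mul_const x))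
  refine (h.congr_of_eventuallyEq ?_).congr_deriv ?_
  · filter_upwards [lt_mem_nhds ht] with s hs
    exact heatK_eq_scaled hs x
  · have h2 : (Real.sqrt t)⁻¹ ^ 2 = t⁻¹ := by rw [inv_pow, Real.sq_sqrt ht.le]
    rw [heatK_eq_scaled ht]
    simp only [Function.comp]
    linear_combination (x ^ 2 / (2 * t) * (Real.sqrt t)⁻¹ * heatK 1 ((Real.sqrt t)⁻¹ * x)) * h2

lemma heatK_le_inv_sqrt {t : ℝ} (ht : 0 < t) (x : ℝ) : heatK t x ≤ (Real.sqrt t)⁻¹ := by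
  have hpi : t ≤ 2 * Real.pi * t := by nlinarith [Real.pi_gt_three]
  have hexp : Real.exp (-x ^ 2 / (2 * t)) ≤ 1 :=
    Real.exp_le_one_iff.2 (div_nonpos_of_nonpos_of_nonneg (by nlinarith [sq_nonneg x])
      (by positivity))
  calc heatK t x ≤ (Real.sqrt (2 * Real.pi * t))⁻¹ * 1 :=
        mul_le_mul_of_nonneg_left hexp (by positivity)
    _ ≤ (Real.sqrt t)⁻¹ := by
        rw [mul_one]
        exact inv_anti₀ (Real.sqrt_pos.2 ht) (Real.sqrt_le_sqrt hpi)

lemma intervalIntegrable_heatK_time {t : ℝ} (ht : 0 < t) (x : ℝ) :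
    IntervalIntegrable (fun s => heatK s x) volume 0 t := by
  have h : IntervalIntegrable (fun s : ℝ => s ^ (-(1 / 2) : ℝ)) volume 0 t :=
    intervalIntegral.intervalIntegrable_rpow' (by norm_num)
  refine h.mono_fun (Measurable.aestronglyMeasurable (by unfold heatK; fun_prop)) ?_
  rw [uIoc_of_le ht.le]
  filter_upwards [ae_restrict_mem measurableSet_Ioc] with s hs
  rw [Real.norm_of_nonneg (heatK_nonneg s x), Real.rpow_neg hs.1.le, ← Real.sqrt_eq_rpow,
    Real.norm_of_nonneg (by positivity)]
  exact heatK_le_inv_sqrt hs.1 x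

lemma tendsto_mul_heatK_zero (x : ℝ) :
    Tendsto (fun s => s * heatK s x) (𝓝[>] 0) (𝓝 0) := by
  have hsqrt : Tendsto Real.sqrt (𝓝[>] 0) (𝓝 0) := by
    simpa using (Real.continuous_sqrt.tendsto 0).mono_left nhdsWithin_le_nhds
  refine squeeze_zero' ?_ ?_ hsqrt
  · filter_upwards [self_mem_nhdsWithin] with s hs
    exact mul_nonneg (le_of_lt hs) (heatK_nonneg s x)
  · filter_upwards [self_mem_nhdsWithin] with s hs
    have hs' : 0 < s := hs
    calc s * heatK s x ≤ s * (Real.sqrt s)⁻¹ :=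
          mul_le_mul_of_nonneg_left (heatK_le_inv_sqrt hs' x) hs'.le
      _ = Real.sqrt s := by rw [← div_eq_mul_inv, Real.div_sqrt]

lemma tendsto_mul_gaussTail_zero {x : ℝ} (hx : 0 ≤ x) :
    Tendsto (fun s => x * gaussTail s x) (𝓝[>] 0) (𝓝 0) := by
  refine squeeze_zero' ?_ ?_ (tendsto_mul_heatK_zero x)
  · exact Eventually.of_forall fun s => mul_nonneg hx (gaussTail_nonneg s x)
  · filter_upwards [self_mem_nhdsWithin] with s hs
    exact mul_gaussTail_le hs hx

lemma integral_heatK_time {t : ℝ} (ht : 0 < t) {x : ℝ} (hx : 0 ≤ x) :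
    ∫ s in (0 : ℝ)..t, 2 * heatK s x = 4 * (t * heatK t x - x * gaussTail t x) := by
  have hd : ∀ s : ℝ, 0 < s →
      HasDerivAt (fun s => 4 * (s * heatK s x - x * gaussTail s x)) (2 * heatK s x) s := by
    intro s hs
    refine ((((hasDerivAt_id s).mul (hasDerivAt_heatK_time hs x)).sub
      ((hasDerivAt_gaussTail_time hs x).const_mul x)).const_mul 4).congr_deriv ?_
    simp only [id]
    field_simp
    ring
  have h0 := ((tendsto_mul_heatK_zero x).sub (tendsto_mul_gaussTail_zero hx)).const_mul 4
  have h := intervalIntegral.integral_eq_sub_of_hasDerivAt_of_tendsto ht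
    (fun s hs => hd s hs.1) ((intervalIntegrable_heatK_time ht x).const_mul 2) h0
    ((hd t ht).continuousAt.tendsto.mono_left nhdsWithin_le_nhds)
  rw [h]
  ring

/-- In the absorption phase (`0 < t ≤ 1/2`), the function
`U*(t,x) := 2p(t,x) + ∫₀ᵗ 2p(t-s,x) ds` is the tail distribution function of `u₁(t,·)`. -/
theorem absorption_phase_tail_distribution
    (t : ℝ) (ht : 0 < t) (ht' : t ≤ 1 / 2) (x : ℝ) (hx : 0 ≤ x) :
    2 * heatK t x + (∫ s in (0:ℝ)..t, 2 * heatK (t - s) x) = ∫ y in Set.Ioi x, u1 t y := by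
  rw [integral_Ioi_u1 ht hx, intervalIntegral.integral_comp_sub_left (fun s => 2 * heatK s x) t,
    sub_self, sub_zero, integral_heatK_time ht hx]
end

section
/- Conservation of mass for the Stefan problem: let (u₂, z₂) be a classical solution of the Stefan problem (see context). Then the total mass t ↦ ∫_{z₂(t)}^∞ u₂(t,x) dx has derivative zero for every t > 0; in particular it is constant in t. -/
open MeasureTheory Real Set

/-- The Neumann heat kernel `p_N(t,y,x) = p(t,y-x) + p(t,y+x)`. -/
noncomputable def heatKN (t y x : ℝ) : ℝ := heatK t (y - x) + heatK t (y + x)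

/-- The space-time domain `D = {(t,x) : t > 0, x ≥ z₂(t)}` of the Stefan problem. -/
def stefanDomain (z₂ : ℝ → ℝ) : Set (ℝ × ℝ) := {q : ℝ × ℝ | 0 < q.1 ∧ z₂ q.1 ≤ q.2}

/-- A classical solution `(u₂, z₂)` of the Stefan problem:
`z₂` is `C¹` on `(0,∞)`, continuous on `[0,∞)`, nondecreasing, with `z₂(0) = 0`;
`u₂` is bounded and integrable on the closure of `D` (in particular integrable on each
slice `[z₂(t),∞)`), and extends to a `C²` function on a neighborhood of the closure of `D`;
`u₂` solves the heat equation `∂ₜu₂ = (1/2)∂ₓₓu₂` for `t > 0`, `x > z₂(t)`;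
`u₂(t, z₂(t)) = 2` for all `t ≥ 0`; and the Stefan boundary condition
`2 z₂'(t) + (1/2)∂ₓu₂(t,z₂(t)) = 0` holds for all `t > 0`. -/
structure StefanSolution (z₂ : ℝ → ℝ) (u₂ : ℝ → ℝ → ℝ) : Prop where
  z_contDiff : ContDiffOn ℝ 1 z₂ (Set.Ioi 0)
  z_cont : ContinuousOn z₂ (Set.Ici 0)
  z_mono : MonotoneOn z₂ (Set.Ici 0)
  z_init : z₂ 0 = 0
  u_bdd : ∃ M : ℝ, ∀ q ∈ closure (stefanDomain z₂), |u₂ q.1 q.2| ≤ M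
  u_int : MeasureTheory.IntegrableOn (fun q : ℝ × ℝ => u₂ q.1 q.2) (closure (stefanDomain z₂))
  u_intSlice : ∀ t : ℝ, 0 ≤ t → MeasureTheory.IntegrableOn (u₂ t) (Set.Ici (z₂ t))
  u_smooth : ∃ V : Set (ℝ × ℝ), IsOpen V ∧ closure (stefanDomain z₂) ⊆ V ∧
      ContDiffOn ℝ 2 (fun q : ℝ × ℝ => u₂ q.1 q.2) V
  heatEq : ∀ t > (0:ℝ), ∀ x : ℝ, z₂ t < x →
      deriv (fun τ : ℝ => u₂ τ x) t = (1 / 2) * deriv (deriv (u₂ t)) x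
  bdryVal : ∀ t ≥ (0:ℝ), u₂ t (z₂ t) = 2
  stefanBC : ∀ t > (0:ℝ), 2 * deriv z₂ t + (1 / 2) * deriv (u₂ t) (z₂ t) = 0

/-- The tail distribution function `𝒰₂(t,x) = ∫ₓ^∞ u₂(t,y) dy`. -/
noncomputable def tailDist (u₂ : ℝ → ℝ → ℝ) (t x : ℝ) : ℝ := ∫ y in Set.Ioi x, u₂ t y

open Filter Topology in
/-- Differentiation under the integral sign over a fixed compact interval. -/
theorem hasDerivAt_intervalIntegral_of_contDiffOn {G : ℝ × ℝ → ℝ} {V : Set (ℝ × ℝ)}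
    (hV : IsOpen V) (hG : ContDiffOn ℝ 1 G V) {t a b : ℝ} (hab : a ≤ b)
    (hK : ∀ x ∈ Icc a b, (t, x) ∈ V) :
    HasDerivAt (fun τ => ∫ x in a..b, G (τ, x))
      (∫ x in a..b, deriv (fun τ => G (τ, x)) t) t := by
  obtain ⟨U, W, hU, -, htU, hKW, hUW⟩ := generalized_tube_lemma (isCompact_singleton (x := t))
    (isCompact_Icc (a := a) (b := b)) hV (by
      rintro ⟨τ, x⟩ ⟨h1, h2⟩
      obtain rfl : τ = t := h1
      exact hK x h2)
  obtain ⟨r, hr, hrU⟩ := Metric.nhds_basis_closedBall.mem_iff.1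
    (hU.mem_nhds (htU (mem_singleton t)))
  have hsub : Metric.closedBall t r ×ˢ Icc a b ⊆ V :=
    (prod_mono hrU hKW).trans hUW
  have hder : ∀ τ x, (τ, x) ∈ V →
      HasDerivAt (fun τ => G (τ, x)) (fderiv ℝ G (τ, x) (1, 0)) τ := by
    intro τ x hx
    have h1 : HasFDerivAt G (fderiv ℝ G (τ, x)) (τ, x) :=
      ((hG.contDiffAt (hV.mem_nhds hx)).differentiableAt one_ne_zero).hasFDerivAt
    exact h1.comp_hasDerivAt τ ((hasDerivAt_id τ).prodMk (hasDerivAt_const τ x))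
  have hcont : ContinuousOn (fun q => fderiv ℝ G q (1, 0)) V :=
    (hG.continuousOn_fderiv_of_isOpen hV le_rfl).clm_apply continuousOn_const
  obtain ⟨C, hC⟩ := ((isCompact_closedBall t r).prod (isCompact_Icc (a := a) (b := b))
    ).exists_bound_of_continuousOn (hcont.mono hsub)
  have hslice : ∀ {H : ℝ × ℝ → ℝ}, ContinuousOn H V → ∀ τ ∈ Metric.closedBall t r,
      IntervalIntegrable (fun x => H (τ, x)) volume a b := by
    intro H hH τ hτ
    apply ContinuousOn.intervalIntegrable
    rw [uIcc_of_le hab]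
    exact hH.comp (by fun_prop) fun x hx => hsub ⟨hτ, hx⟩
  have hmem : Metric.closedBall t r ∈ 𝓝 t := Metric.closedBall_mem_nhds t hr
  have htr : t ∈ Metric.closedBall t r := Metric.mem_closedBall_self hr.le
  have hIoc : ∀ x ∈ uIoc a b, x ∈ Icc a b := fun x hx =>
    Ioc_subset_Icc_self (by rwa [uIoc_of_le hab] at hx)
  have key := (intervalIntegral.hasDerivAt_integral_of_dominated_loc_of_deriv_le (𝕜 := ℝ) (E := ℝ)
    (F := fun τ x => G (τ, x)) (F' := fun τ x => fderiv ℝ G (τ, x) (1, 0))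
    (bound := fun _ => C) (μ := volume) (a := a) (b := b) hmem
    (by
      filter_upwards [hmem] with τ hτ
      exact (intervalIntegrable_iff.1 (hslice hG.continuousOn τ hτ)).aestronglyMeasurable)
    (hslice hG.continuousOn t htr)
    (intervalIntegrable_iff.1 (hslice hcont t htr)).aestronglyMeasurable
    (ae_of_all _ fun x hx τ hτ => hC (τ, x) ⟨hτ, hIoc x hx⟩)
    intervalIntegrable_const
    (ae_of_all _ fun x hx τ hτ => hder τ x (hsub ⟨hτ, hIoc x hx⟩))).2
  have heq : ∫ x in a..b, deriv (fun τ => G (τ, x)) t =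
      ∫ x in a..b, fderiv ℝ G (t, x) (1, 0) := by
    refine intervalIntegral.integral_congr fun x hx => ?_
    rw [uIcc_of_le hab] at hx
    exact (hder t x (hK x hx)).deriv
  rwa [heq]

open Filter Topology Asymptotics in
/-- Derivative, at the point where the interval degenerates, of the integral of a continuous
function over an interval with a moving endpoint. -/
theorem hasDerivAt_intervalIntegral_moving_endpoint {G : ℝ × ℝ → ℝ} {V : Set (ℝ × ℝ)}
    (hV : IsOpen V) (hG : ContinuousOn G V) {z : ℝ → ℝ} {z' t : ℝ} (hz : HasDerivAt z z' t)
    (ht : (t, z t) ∈ V) :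
    HasDerivAt (fun τ => ∫ x in z t..z τ, G (τ, x)) (G (t, z t) * z') t := by
  have hnear : ∀ ε > 0, ∀ᶠ τ in 𝓝 t, ∀ x ∈ uIcc (z t) (z τ),
      (τ, x) ∈ V ∧ |G (τ, x) - G (t, z t)| ≤ ε := by
    intro ε hε
    have h1 : ∀ᶠ q in 𝓝 (t, z t), q ∈ V ∧ |G q - G (t, z t)| ≤ ε := by
      filter_upwards [hV.mem_nhds ht,
        (hG.continuousAt (hV.mem_nhds ht)).eventually (Metric.closedBall_mem_nhds _ hε)]
        with q hq1 hq2
      exact ⟨hq1, by simpa [Real.dist_eq] using hq2⟩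
    rw [nhds_prod_eq] at h1
    obtain ⟨p, hp, s, hs, hps⟩ := eventually_prod_iff.1 h1
    obtain ⟨δ, hδ, hδs⟩ := Metric.nhds_basis_ball.eventually_iff.1 hs
    filter_upwards [hp, hz.continuousAt.eventually (Metric.ball_mem_nhds _ hδ)] with τ h2 h3 x hx
    refine hps h2 (hδs ?_)
    rw [Real.dist_eq] at h3
    rw [Metric.mem_ball, Real.dist_eq]
    exact (abs_sub_left_of_mem_uIcc hx).trans_lt h3
  have hR : HasDerivAt (fun τ => ∫ x in z t..z τ, (G (τ, x) - G (t, z t))) 0 t := by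
    rw [hasDerivAt_iff_isLittleO]
    simp only [intervalIntegral.integral_same, smul_zero, sub_zero]
    refine IsLittleO.trans_isBigO ?_ hz.isBigO_sub
    refine isLittleO_iff.2 fun ε hε => ?_
    filter_upwards [hnear ε hε] with τ hτ
    exact intervalIntegral.norm_integral_le_of_norm_le_const fun x hx =>
      (hτ x (uIoc_subset_uIcc hx)).2
  have hL : HasDerivAt (fun τ => G (t, z t) * (z τ - z t)) (G (t, z t) * z') t :=
    (hz.sub_const (z t)).const_mul _
  have := hR.add hL
  rw [zero_add] at this
  refine this.congr_of_eventuallyEq ?_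
  filter_upwards [hnear 1 one_pos] with τ hτ
  have hi : IntervalIntegrable (fun x => G (τ, x)) volume (z t) (z τ) :=
    ContinuousOn.intervalIntegrable
      (hG.comp (by fun_prop) fun x hx => (hτ x hx).1)
  simp only [Pi.add_apply]
  rw [intervalIntegral.integral_sub hi intervalIntegrable_const, intervalIntegral.integral_const,
    smul_eq_mul]
  ring

open Filter Topology in
/-- Leibniz rule for an integral with a moving left endpoint. -/
theorem hasDerivAt_intervalIntegral_moving_left {G : ℝ × ℝ → ℝ} {V : Set (ℝ × ℝ)}
    (hV : IsOpen V) (hG : ContDiffOn ℝ 1 G V) {z : ℝ → ℝ} {z' t b : ℝ} (hz : HasDerivAt z z' t)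
    (hb : z t ≤ b) (hK : ∀ x ∈ Icc (z t) b, (t, x) ∈ V) :
    HasDerivAt (fun τ => ∫ x in z τ..b, G (τ, x))
      ((∫ x in z t..b, deriv (fun τ => G (τ, x)) t) - G (t, z t) * z') t := by
  have hmem := hK (z t) (left_mem_Icc.2 hb)
  refine ((hasDerivAt_intervalIntegral_of_contDiffOn hV hG hb hK).sub
    (hasDerivAt_intervalIntegral_moving_endpoint hV hG.continuousOn hz hmem)
    ).congr_of_eventuallyEq ?_
  obtain ⟨U, W, hU, hW, htU, hKW, hUW⟩ := generalized_tube_lemma (isCompact_singleton (x := t))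
    (isCompact_Icc (a := z t) (b := b)) hV (by
      rintro ⟨τ, x⟩ ⟨h1, h2⟩
      obtain rfl : τ = t := h1
      exact hK x h2)
  obtain ⟨δ, hδ, hδW⟩ := Metric.nhds_basis_ball.mem_iff.1
    (hW.mem_nhds (hKW (left_mem_Icc.2 hb)))
  filter_upwards [hU.mem_nhds (htU (mem_singleton t)),
    hz.continuousAt.eventually (Metric.ball_mem_nhds _ hδ)] with τ hτ hzτ
  have hint : ∀ c d, uIcc c d ⊆ W → IntervalIntegrable (fun x => G (τ, x)) volume c d :=
    fun c d hcd => ContinuousOn.intervalIntegrable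
      (hG.continuousOn.comp (by fun_prop) fun x hx => hUW ⟨hτ, hcd hx⟩)
  have h1 : IntervalIntegrable (fun x => G (τ, x)) volume (z t) (z τ) := by
    refine hint _ _ fun x hx => hδW ?_
    rw [Real.dist_eq] at hzτ
    rw [Metric.mem_ball, Real.dist_eq]
    exact (abs_sub_left_of_mem_uIcc hx).trans_lt hzτ
  have h2 : IntervalIntegrable (fun x => G (τ, x)) volume (z t) b :=
    hint _ _ (by rwa [uIcc_of_le hb])
  simp only [Pi.sub_apply]
  rw [intervalIntegral.integral_interval_sub_left h2 h1]

/-- Two integrations by parts against the cutoff `(1 - x / L) ^ 2`, which vanishes to second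
order at `L`. -/
theorem integral_deriv_deriv_mul_cutoff {f : ℝ → ℝ} {S : Set ℝ} (hS : IsOpen S)
    (hf : ContDiffOn ℝ 2 f S) {a L : ℝ} (haL : a ≤ L) (hL : L ≠ 0) (hsub : Icc a L ⊆ S) :
    ∫ x in a..L, deriv (deriv f) x * (1 - x / L) ^ 2 =
      -(deriv f a * (1 - a / L) ^ 2) - f a * (2 / L * (1 - a / L))
        + 2 / L ^ 2 * ∫ x in a..L, f x := by
  have hf1 : ContDiffOn ℝ 1 (deriv f) S := hf.deriv_of_isOpen hS (by norm_num)
  have hf2 : ContinuousOn (deriv (deriv f)) S := hf1.continuousOn_deriv_of_isOpen hS le_rfl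
  have hsub' : uIcc a L ⊆ S := by rwa [uIcc_of_le haL]
  have hd : ∀ x ∈ uIcc a L, HasDerivAt
      (fun x => deriv f x * (1 - x / L) ^ 2 + f x * (2 / L * (1 - x / L)))
      (deriv (deriv f) x * (1 - x / L) ^ 2 - 2 / L ^ 2 * f x) x := by
    intro x hx
    have hn := hS.mem_nhds (hsub' hx)
    have h1 : HasDerivAt f (deriv f x) x :=
      ((hf.contDiffAt hn).differentiableAt two_ne_zero).hasDerivAt
    have h2 : HasDerivAt (deriv f) (deriv (deriv f) x) x :=
      ((hf1.contDiffAt hn).differentiableAt one_ne_zero).hasDerivAt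
    have h3 : HasDerivAt (fun x : ℝ => 1 - x / L) (-(1 / L)) x :=
      ((hasDerivAt_id x).div_const L).const_sub 1
    refine ((h2.mul (h3.pow 2)).add (h1.mul (h3.const_mul (2 / L)))).congr_deriv ?_
    simp only [Pi.pow_apply, Nat.cast_ofNat]
    ring
  have hi1 : IntervalIntegrable (fun x => deriv (deriv f) x * (1 - x / L) ^ 2) volume a L :=
    ((hf2.mono hsub').mul (by fun_prop)).intervalIntegrable
  have hi2 : IntervalIntegrable (fun x => 2 / L ^ 2 * f x) volume a L :=
    (continuousOn_const.mul (hf.continuousOn.mono hsub')).intervalIntegrable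
  have := intervalIntegral.integral_eq_sub_of_hasDerivAt hd (hi1.sub hi2)
  rw [intervalIntegral.integral_sub hi1 hi2, intervalIntegral.integral_const_mul,
    div_self hL] at this
  linear_combination this

open Filter Topology in
/-- Integrals against the cutoffs `(1 - x / L) ^ 2` exhaust the integral over a half-line. -/
theorem tendsto_intervalIntegral_mul_cutoff {f : ℝ → ℝ} {a : ℝ} (ha : 0 ≤ a)
    (hf : IntegrableOn f (Ici a)) :
    Tendsto (fun L : ℝ => ∫ x in a..L, f x * (1 - x / L) ^ 2) atTop
      (𝓝 (∫ x in Ici a, f x)) := by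
  rw [integral_Ici_eq_integral_Ioi]
  have hf' : IntegrableOn f (Ioi a) := hf.mono_set Ioi_subset_Ici_self
  have key : Tendsto (fun L : ℝ => ∫ x in Ioi a,
      (Iic L).indicator (fun x => f x * (1 - x / L) ^ 2) x) atTop (𝓝 (∫ x in Ioi a, f x)) := by
    refine tendsto_integral_filter_of_dominated_convergence (fun x => ‖f x‖) ?_ ?_ hf'.norm ?_
    · refine Eventually.of_forall fun L => ?_
      refine (hf'.aestronglyMeasurable.mul ?_).indicator measurableSet_Iic
      exact Continuous.aestronglyMeasurable (by fun_prop)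
    · filter_upwards [eventually_gt_atTop 0] with L hL
      filter_upwards [ae_restrict_mem measurableSet_Ioi] with x hx
      by_cases hxL : x ≤ L
      · have hx0 : 0 ≤ x := ha.trans (le_of_lt hx)
        have h1 : 0 ≤ x / L := by positivity
        have h2 : x / L ≤ 1 := (div_le_one hL).2 hxL
        rw [indicator_of_mem (show x ∈ Iic L from hxL), norm_mul]
        refine mul_le_of_le_one_right (norm_nonneg _) ?_
        rw [Real.norm_of_nonneg (by positivity)]
        exact pow_le_one₀ (by linarith) (by linarith)
      · rw [indicator_of_notMem (show x ∉ Iic L from hxL), norm_zero]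
        exact norm_nonneg _
    · refine ae_of_all _ fun x => ?_
      have h1 : Tendsto (fun L : ℝ => f x * (1 - x / L) ^ 2) atTop (𝓝 (f x * (1 - 0) ^ 2)) :=
        (((tendsto_const_nhds (x := x)).div_atTop tendsto_id).const_sub 1 |>.pow 2).const_mul _
      rw [sub_zero, one_pow, mul_one] at h1
      refine h1.congr' ?_
      filter_upwards [eventually_ge_atTop x] with L hL
      rw [indicator_of_mem (show x ∈ Iic L from hL)]
  refine key.congr' ?_
  filter_upwards [eventually_ge_atTop a] with L hL
  rw [intervalIntegral.integral_of_le hL, setIntegral_indicator measurableSet_Iic,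
    Ioi_inter_Iic]

namespace StefanSolution

variable {z₂ : ℝ → ℝ} {u₂ : ℝ → ℝ → ℝ}

theorem z_nonneg (h : StefanSolution z₂ u₂) {t : ℝ} (ht : 0 ≤ t) : 0 ≤ z₂ t := by
  have := h.z_mono self_mem_Ici ht ht
  rwa [h.z_init] at this

/-- The time derivative of the mass weighted by the cutoff `(1 - x / L) ^ 2`. -/
theorem hasDerivAt_cutoff_mass (h : StefanSolution z₂ u₂) {t L : ℝ} (ht : 0 < t) (hL : 0 < L)
    (hzL : z₂ t ≤ L) :
    HasDerivAt (fun τ => ∫ x in z₂ τ..L, u₂ τ x * (1 - x / L) ^ 2)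
      (-(2 / L * (1 - z₂ t / L)) + 1 / L ^ 2 * ∫ x in z₂ t..L, u₂ t x) t := by
  obtain ⟨V, hV, hDV, hu⟩ := h.u_smooth
  have hmem : ∀ x, z₂ t ≤ x → (t, x) ∈ V := fun x hx => hDV (subset_closure ⟨ht, hx⟩)
  have hz : HasDerivAt z₂ (deriv z₂ t) t :=
    ((h.z_contDiff.contDiffAt (Ioi_mem_nhds ht)).differentiableAt one_ne_zero).hasDerivAt
  have hG : ContDiffOn ℝ 1 (fun q : ℝ × ℝ => u₂ q.1 q.2 * (1 - q.2 / L) ^ 2) V :=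
    (hu.of_le (by norm_num)).mul (ContDiff.contDiffOn (by fun_prop))
  have key := hasDerivAt_intervalIntegral_moving_left hV hG hz hzL fun x hx => hmem x hx.1
  refine key.congr_deriv ?_
  have hS : IsOpen {x | (t, x) ∈ V} := hV.preimage (by fun_prop)
  have hf : ContDiffOn ℝ 2 (u₂ t) {x | (t, x) ∈ V} :=
    hu.comp (ContDiff.contDiffOn (f := fun x : ℝ => (t, x)) (by fun_prop)) fun x hx => hx
  have hint : ∫ x in z₂ t..L, deriv (fun τ => u₂ τ x * (1 - x / L) ^ 2) t =
      1 / 2 * ∫ x in z₂ t..L, deriv (deriv (u₂ t)) x * (1 - x / L) ^ 2 := by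
    rw [← intervalIntegral.integral_const_mul]
    refine intervalIntegral.integral_congr_ae (ae_of_all _ fun x hx => ?_)
    rw [uIoc_of_le hzL] at hx
    rw [deriv_mul_const_field, h.heatEq t ht x hx.1]
    ring
  simp only
  rw [hint, integral_deriv_deriv_mul_cutoff hS hf hzL hL.ne' fun x hx => hmem x hx.1,
    h.bdryVal t ht.le]
  linear_combination -(1 - z₂ t / L) ^ 2 * h.stefanBC t ht

theorem exists_cutoff_mass_deriv_bound (h : StefanSolution z₂ u₂) :
    ∃ C : ℝ, ∀ t L : ℝ, 0 < t → 0 < L → z₂ t ≤ L →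
      ‖-(2 / L * (1 - z₂ t / L)) + 1 / L ^ 2 * ∫ x in z₂ t..L, u₂ t x‖ ≤ C / L := by
  obtain ⟨M, hM⟩ := h.u_bdd
  refine ⟨2 + M, fun t L ht hL hzL => ?_⟩
  have hz0 := h.z_nonneg ht.le
  have h1 : ‖∫ x in z₂ t..L, u₂ t x‖ ≤ M * |L - z₂ t| :=
    intervalIntegral.norm_integral_le_of_norm_le_const fun x hx => by
      rw [uIoc_of_le hzL] at hx
      exact hM (t, x) (subset_closure ⟨ht, hx.1.le⟩)
  have hM0 : 0 ≤ M := (abs_nonneg _).trans (hM (t, z₂ t) (subset_closure ⟨ht, le_rfl⟩))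
  have h2 : ‖∫ x in z₂ t..L, u₂ t x‖ ≤ M * L := by
    refine h1.trans (mul_le_mul_of_nonneg_left ?_ hM0)
    rw [abs_of_nonneg (by linarith)]
    linarith
  have h3 : 0 ≤ z₂ t / L := by positivity
  have h4 : z₂ t / L ≤ 1 := (div_le_one hL).2 hzL
  calc _ ≤ ‖-(2 / L * (1 - z₂ t / L))‖ + ‖1 / L ^ 2 * ∫ x in z₂ t..L, u₂ t x‖ := norm_add_le _ _
    _ ≤ 2 / L * 1 + 1 / L ^ 2 * (M * L) := by
      rw [norm_neg, norm_mul, norm_mul, Real.norm_of_nonneg (by positivity : 0 ≤ 2 / L),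
        Real.norm_of_nonneg (by linarith : 0 ≤ 1 - z₂ t / L),
        Real.norm_of_nonneg (by positivity : 0 ≤ 1 / L ^ 2)]
      gcongr
      linarith
    _ = (2 + M) / L := by
      field_simp

open Filter Topology in
theorem mass_eq (h : StefanSolution z₂ u₂) {s t : ℝ} (hs : 0 < s) (hst : s ≤ t) :
    (∫ x in Ici (z₂ t), u₂ t x) = ∫ x in Ici (z₂ s), u₂ s x := by
  obtain ⟨C, hC⟩ := h.exists_cutoff_mass_deriv_bound
  have ht : 0 < t := hs.trans_le hst
  have hlim : ∀ τ, 0 < τ → Tendsto (fun L : ℝ => ∫ x in z₂ τ..L, u₂ τ x * (1 - x / L) ^ 2) atTop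
      (𝓝 (∫ x in Ici (z₂ τ), u₂ τ x)) := fun τ hτ =>
    tendsto_intervalIntegral_mul_cutoff (h.z_nonneg hτ.le) (h.u_intSlice τ hτ.le)
  have hdiff := (hlim t ht).sub (hlim s hs)
  refine sub_eq_zero.1 (tendsto_nhds_unique hdiff ?_)
  have hbound : Tendsto (fun L : ℝ => C / L * ‖t - s‖) atTop (𝓝 0) := by
    simpa using ((tendsto_const_nhds (x := C)).div_atTop tendsto_id).mul_const ‖t - s‖
  refine squeeze_zero_norm' ?_ hbound
  filter_upwards [eventually_gt_atTop 0, eventually_ge_atTop (z₂ t)] with L hL hzL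
  have hle : ∀ τ ∈ Icc s t, z₂ τ ≤ L := fun τ hτ =>
    (h.z_mono (hs.le.trans hτ.1) ht.le hτ.2).trans hzL
  exact (convex_Icc s t).norm_image_sub_le_of_norm_hasDerivWithin_le
    (fun τ hτ => (h.hasDerivAt_cutoff_mass (hs.trans_le hτ.1) hL (hle τ hτ)).hasDerivWithinAt)
    (fun τ hτ => hC τ L (hs.trans_le hτ.1) hL (hle τ hτ))
    (left_mem_Icc.2 hst) (right_mem_Icc.2 hst)

end StefanSolution

/-- Conservation of mass for the Stefan problem: the total mass
`t ↦ ∫_{z₂(t)}^∞ u₂(t,x) dx` has derivative zero at every `t > 0`;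
in particular it is constant on `(0,∞)`. -/
theorem stefan_conservation_of_mass (z₂ : ℝ → ℝ) (u₂ : ℝ → ℝ → ℝ)
    (h : StefanSolution z₂ u₂) :
    (∀ t > (0:ℝ), HasDerivAt (fun τ : ℝ => ∫ x in Set.Ici (z₂ τ), u₂ τ x) 0 t) ∧
    (∀ t > (0:ℝ), ∀ t' > (0:ℝ),
      (∫ x in Set.Ici (z₂ t), u₂ t x) = ∫ x in Set.Ici (z₂ t'), u₂ t' x) := by
  have hconst : ∀ t > (0:ℝ), ∀ t' > (0:ℝ),
      (∫ x in Set.Ici (z₂ t), u₂ t x) = ∫ x in Set.Ici (z₂ t'), u₂ t' x := by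
    intro t ht t' ht'
    rcases le_total t t' with htt | htt
    · exact (h.mass_eq ht htt).symm
    · exact h.mass_eq ht' htt
  refine ⟨fun t ht => ?_, hconst⟩
  refine (hasDerivAt_const t (∫ x in Set.Ici (z₂ t), u₂ t x)).congr_of_eventuallyEq ?_
  filter_upwards [Ioi_mem_nhds ht] with τ hτ
  exact hconst τ hτ t ht
end
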